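/- arXiv:2203.11345 — 8 statements merged into one kernel-verified Lean document; each statement's English description precedes it below -/
import Mathlib

section
/- Let n ≥ 1, let F : ℝⁿ → ℝⁿ be continuously differentiable, and suppose there are constants 0 < κ < 1 and ρ > 0, a point w₀ ∈ ℝⁿ, and an invertible matrix A ∈ ℝ^{n×n} such that ‖I − A⁻¹·DF(w)‖ ≤ κ for all w in the closed ball B_ρ(w₀) of radius ρ centered at w₀, and ‖A⁻¹·F(w₀)‖ ≤ (1−κ)ρ. Then F has a unique root w₊ in B_ρ(w₀), and this root satisfies ‖w₊ − w₀‖ ≤ (1/(1−κ))·‖A⁻¹·F(w₀)‖. -/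
open Metric Set in
/-- A map which is `κ`-Lipschitz with `κ < 1` on a closed ball, and which moves the center by at most
`(1 - κ) * ρ`, has a unique fixed point in that ball, with an explicit bound on its distance to the
center. -/
theorem exists_unique_fixedPoint_of_norm_sub_le {E : Type*} [NormedAddCommGroup E]
    [CompleteSpace E] {T : E → E} {κ ρ : ℝ} {x₀ : E} (hκ0 : 0 ≤ κ) (hκ1 : κ < 1) (hρ : 0 ≤ ρ)
    (hT : ∀ x ∈ closedBall x₀ ρ, ∀ y ∈ closedBall x₀ ρ, ‖T x - T y‖ ≤ κ * ‖x - y‖)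
    (hx₀ : ‖T x₀ - x₀‖ ≤ (1 - κ) * ρ) :
    ∃ x ∈ closedBall x₀ ρ, T x = x ∧ ‖x - x₀‖ ≤ 1 / (1 - κ) * ‖T x₀ - x₀‖ ∧
      ∀ y ∈ closedBall x₀ ρ, T y = y → y = x := by
  have hc : x₀ ∈ closedBall x₀ ρ := mem_closedBall_self hρ
  have hκ : 0 < 1 - κ := sub_pos.2 hκ1
  have hmaps : MapsTo T (closedBall x₀ ρ) (closedBall x₀ ρ) := by
    intro x hx
    have hlip := hT x hx x₀ hc
    rw [mem_closedBall, dist_eq_norm] at hx ⊢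
    have htri := norm_sub_le_norm_sub_add_norm_sub (T x) (T x₀) x₀
    have hmul := mul_le_mul_of_nonneg_left hx hκ0
    linarith
  have hcontr : ContractingWith ⟨κ, hκ0⟩ (hmaps.restrict T _ _) := by
    refine ⟨hκ1, LipschitzWith.of_dist_le_mul fun x y => ?_⟩
    rw [Subtype.dist_eq, Subtype.dist_eq, dist_eq_norm, dist_eq_norm]
    exact hT x x.2 y y.2
  obtain ⟨x, hx, hfix, -⟩ := hcontr.exists_fixedPoint' isClosed_closedBall.isComplete hmaps hc
    (edist_ne_top _ _)
  have hfix : T x = x := hfix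
  refine ⟨x, hx, hfix, ?_, fun y hy hyfix => ?_⟩
  · have hlip := hT x hx x₀ hc
    have htri := norm_sub_le_norm_sub_add_norm_sub (T x) (T x₀) x₀
    rw [hfix] at hlip htri
    rw [one_div_mul_eq_div, le_div_iff₀ hκ]
    linarith
  · have hlip := hT y hy x hx
    rw [hyfix, hfix] at hlip
    have hzero : ‖y - x‖ = 0 := by nlinarith [norm_nonneg (y - x)]
    exact sub_eq_zero.1 (norm_eq_zero.1 hzero)

/-- Newton–Kantorovich-type root-finding lemma (Lemma on roots, Bramburger et al.):
if `‖I − A⁻¹ DF(w)‖ ≤ κ < 1` on the closed ball of radius `ρ` about `w₀` and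
`‖A⁻¹ F(w₀)‖ ≤ (1−κ)ρ`, then `F` has a unique root `w₊` in that ball, with
`‖w₊ − w₀‖ ≤ (1/(1−κ)) ‖A⁻¹ F(w₀)‖`. -/
theorem stmt_0 (n : ℕ) (hn : 1 ≤ n)
    (F : EuclideanSpace ℝ (Fin n) → EuclideanSpace ℝ (Fin n))
    (hF : ContDiff ℝ 1 F)
    (κ ρ : ℝ) (hκ0 : 0 < κ) (hκ1 : κ < 1) (hρ : 0 < ρ)
    (w₀ : EuclideanSpace ℝ (Fin n))
    (A : EuclideanSpace ℝ (Fin n) ≃L[ℝ] EuclideanSpace ℝ (Fin n))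
    (hA : ∀ w ∈ Metric.closedBall w₀ ρ,
      ‖ContinuousLinearMap.id ℝ (EuclideanSpace ℝ (Fin n)) -
        (A.symm : EuclideanSpace ℝ (Fin n) →L[ℝ] EuclideanSpace ℝ (Fin n)).comp
          (fderiv ℝ F w)‖ ≤ κ)
    (hF0 : ‖A.symm (F w₀)‖ ≤ (1 - κ) * ρ) :
    ∃ w : EuclideanSpace ℝ (Fin n),
      w ∈ Metric.closedBall w₀ ρ ∧ F w = 0 ∧
      ‖w - w₀‖ ≤ (1 / (1 - κ)) * ‖A.symm (F w₀)‖ ∧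
      ∀ w' ∈ Metric.closedBall w₀ ρ, F w' = 0 → w' = w := by
  set T : EuclideanSpace ℝ (Fin n) → EuclideanSpace ℝ (Fin n) :=
    fun w => w - A.symm (F w) with hTdef
  have hderiv (w) : HasFDerivAt T (ContinuousLinearMap.id ℝ (EuclideanSpace ℝ (Fin n)) -
      (A.symm : EuclideanSpace ℝ (Fin n) →L[ℝ] EuclideanSpace ℝ (Fin n)).comp (fderiv ℝ F w)) w :=
    (hasFDerivAt_id w).sub
      (A.symm.hasFDerivAt.comp w (hF.differentiable one_ne_zero w).hasFDerivAt)
  have hfix (w) : T w = w ↔ F w = 0 := by simp [hTdef]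
  have hnorm : ‖T w₀ - w₀‖ = ‖A.symm (F w₀)‖ := by simp [hTdef]
  obtain ⟨w, hw, hwfix, hdist, huniq⟩ := exists_unique_fixedPoint_of_norm_sub_le hκ0.le hκ1 hρ.le
    (fun x hx y hy => (convex_closedBall w₀ ρ).norm_image_sub_le_of_norm_hasFDerivWithin_le
      (fun z _ => (hderiv z).hasFDerivWithinAt) hA hy hx) (hnorm.trans_le hF0)
  exact ⟨w, hw, (hfix w).1 hwfix, hnorm ▸ hdist, fun w' hw' h => huniq w' hw' ((hfix w').2 h)⟩
end

section
/- Let μ, ν ∈ ℝ, let I ⊂ ℝ be an open interval, let V : ℝ × I → ℝ be smooth with V(y+1,h) = V(y,h) for all (y,h), and let p : I → (0,∞) be smooth. Define U(x,h) := V(x/p(h), h) and assume that for each h ∈ I: (a) U(·,h) satisfies the stationary Swift–Hohenberg equation U'''' + 2U'' + (1+μ)U − νU² + U³ = 0 (derivatives in x), and (b) the pointwise identity U_x U_xxx − U_xx²/2 + U_x² + U²/2 + μU²/2 − νU³/3 + U⁴/4 = h holds for all x. Define E(h) := ∫₀¹ [ (1/2)(V(y,h) + p(h)⁻²·V_yy(y,h))²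 + μV(y,h)²/2 − νV(y,h)³/3 + V(y,h)⁴/4 ] dy. Then E is differentiable and E'(h) = −(p'(h)/p(h))·(E(h) − h) for every h ∈ I. -/
open Set

/-- Differentiation under the integral sign over a compact interval, for an integrand with a
continuous partial derivative in the parameter. -/
lemma hasDerivAt_intervalIntegral_of_continuousOn {I : Set ℝ} (hI : IsOpen I) {G G' : ℝ × ℝ → ℝ}
    (hG : ContinuousOn G (univ ×ˢ I)) (hG' : ContinuousOn G' (univ ×ˢ I))
    (hd : ∀ y, ∀ h ∈ I, HasDerivAt (fun h => G (y, h)) (G' (y, h)) h) (a b : ℝ) {h₀ : ℝ}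
    (h₀I : h₀ ∈ I) :
    HasDerivAt (fun h => ∫ y in a..b, G (y, h)) (∫ y in a..b, G' (y, h₀)) h₀ := by
  have slice : ∀ {F : ℝ × ℝ → ℝ}, ContinuousOn F (univ ×ˢ I) → ∀ h ∈ I,
      Continuous fun y => F (y, h) := fun hF h hh =>
    hF.comp_continuous (by fun_prop) fun y => ⟨mem_univ _, hh⟩
  obtain ⟨ε, hε, hball⟩ := Metric.nhds_basis_closedBall.mem_iff.1 (hI.mem_nhds h₀I)
  obtain ⟨C, hC⟩ := (isCompact_uIcc.prod (isCompact_closedBall h₀ ε)).exists_bound_of_continuousOn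
    (hG'.mono (prod_mono (subset_univ (uIcc a b)) hball))
  refine (intervalIntegral.hasDerivAt_integral_of_dominated_loc_of_deriv_le
    (F := fun h y => G (y, h)) (F' := fun h y => G' (y, h)) (bound := fun _ => C)
    (Metric.closedBall_mem_nhds h₀ hε) ?_ ((slice hG h₀ h₀I).intervalIntegrable _ _)
    (slice hG' h₀ h₀I).aestronglyMeasurable ?_ intervalIntegrable_const ?_).2
  · filter_upwards [hI.mem_nhds h₀I] with h hh using (slice hG h hh).aestronglyMeasurable
  · exact .of_forall fun y hy h hh => hC (y, h) ⟨uIoc_subset_uIcc hy, hh⟩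
  · exact .of_forall fun y _ h hh => hd y h (hball hh)

section DirectionalDerivative

variable {E : Type*} [NormedAddCommGroup E] [NormedSpace ℝ E] {f : E → ℝ} {s : Set E}

lemma ContDiffOn.fderiv_apply_of_isOpen (hs : IsOpen s) (hf : ContDiffOn ℝ (⊤ : ℕ∞) f s) (v : E) :
    ContDiffOn ℝ (⊤ : ℕ∞) (fun q => fderiv ℝ f q v) s :=
  (hf.fderiv_of_isOpen hs (by simp)).clm_apply contDiffOn_const

lemma ContDiffOn.hasFDerivAt_of_isOpen (hs : IsOpen s) (hf : ContDiffOn ℝ (⊤ : ℕ∞) f s) {q : E}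
    (hq : q ∈ s) : HasFDerivAt f (fderiv ℝ f q) q :=
  ((hf.contDiffAt (hs.mem_nhds hq)).differentiableAt (by simp)).hasFDerivAt

lemma ContDiffOn.fderiv_fderiv_apply_comm (hs : IsOpen s) (hf : ContDiffOn ℝ (⊤ : ℕ∞) f s) {q : E}
    (hq : q ∈ s) (v w : E) :
    fderiv ℝ (fun q => fderiv ℝ f q v) q w = fderiv ℝ (fun q => fderiv ℝ f q w) q v := by
  have hd : DifferentiableAt ℝ (fderiv ℝ f) q :=
    ((hf.fderiv_of_isOpen hs (m := (⊤ : ℕ∞)) (by simp)).contDiffAt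
      (hs.mem_nhds hq)).differentiableAt (by simp)
  have key : ∀ u z : E, fderiv ℝ (fun q => fderiv ℝ f q u) q z = fderiv ℝ (fderiv ℝ f) q z u := by
    intro u z
    rw [fderiv_clm_apply hd (differentiableAt_const u)]
    simp
  rw [key, key]
  exact (hf.contDiffAt (hs.mem_nhds hq)).isSymmSndFDerivAt
    (by rw [minSmoothness_of_isRCLikeNormedField]; exact WithTop.coe_le_coe.2 (le_top : (2 : ℕ∞) ≤ ⊤)) w v

end DirectionalDerivative

section PartialDerivative

variable {f : ℝ × ℝ → ℝ} {s : Set (ℝ × ℝ)}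

lemma ContDiffOn.hasDerivAt_fst (hs : IsOpen s) (hf : ContDiffOn ℝ (⊤ : ℕ∞) f s) {y h : ℝ}
    (hq : (y, h) ∈ s) : HasDerivAt (fun y => f (y, h)) (fderiv ℝ f (y, h) (1, 0)) y :=
  (hf.hasFDerivAt_of_isOpen hs hq).comp_hasDerivAt y
    ((hasDerivAt_id y).prodMk (hasDerivAt_const y h))

lemma ContDiffOn.hasDerivAt_snd (hs : IsOpen s) (hf : ContDiffOn ℝ (⊤ : ℕ∞) f s) {y h : ℝ}
    (hq : (y, h) ∈ s) : HasDerivAt (fun h => f (y, h)) (fderiv ℝ f (y, h) (0, 1)) h :=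
  (hf.hasFDerivAt_of_isOpen hs hq).comp_hasDerivAt h
    ((hasDerivAt_const h y).prodMk (hasDerivAt_id h))

end PartialDerivative

lemma fderiv_apply_periodic {E : Type*} [NormedAddCommGroup E] [NormedSpace ℝ E] {f : E → ℝ}
    {c : E} (hf : Function.Periodic f c) (v : E) :
    Function.Periodic (fun q => fderiv ℝ f q v) c := by
  intro q
  change fderiv ℝ f (q + c) v = fderiv ℝ f q v
  rw [← fderiv_comp_add_right, show (fun x => f (x + c)) = f from funext hf]

lemma deriv_const_mul_comp_div {k k' : ℝ → ℝ} (hk : ∀ y, HasDerivAt k (k' y) y) (c p : ℝ) :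
    deriv (fun x => c * k (x / p)) = fun x => c * p⁻¹ * k' (x / p) := by
  ext x
  have := ((hk (x / p)).comp x ((hasDerivAt_id x).div_const p)).const_mul c
  refine (this.congr_deriv ?_).deriv
  simp only [one_div]
  ring


/-- Derivative of the averaged Swift–Hohenberg PDE energy with respect to the
Hamiltonian level `h`: `E'(h) = −(p'(h)/p(h))·(E(h) − h)`. -/
theorem stmt_2 (μ ν a b : ℝ) (I : Set ℝ) (hIdef : I = Set.Ioo a b)
    (V : ℝ → ℝ → ℝ)
    (hV : ContDiffOn ℝ (⊤ : ℕ∞) (fun q : ℝ × ℝ => V q.1 q.2) (Set.univ ×ˢ I))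
    (hVper : ∀ y h, V (y + 1) h = V y h)
    (p : ℝ → ℝ) (hp : ContDiffOn ℝ (⊤ : ℕ∞) p I) (hppos : ∀ h ∈ I, 0 < p h)
    (U : ℝ → ℝ → ℝ) (hUdef : ∀ x h, U x h = V (x / p h) h)
    (hSH : ∀ h ∈ I, ∀ x : ℝ,
      deriv^[4] (fun x' => U x' h) x + 2 * deriv^[2] (fun x' => U x' h) x
        + (1 + μ) * U x h - ν * (U x h) ^ 2 + (U x h) ^ 3 = 0)
    (hHam : ∀ h ∈ I, ∀ x : ℝ,
      deriv (fun x' => U x' h) x * deriv^[3] (fun x' => U x' h) x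
        - (deriv^[2] (fun x' => U x' h) x) ^ 2 / 2 + (deriv (fun x' => U x' h) x) ^ 2
        + (U x h) ^ 2 / 2 + μ * (U x h) ^ 2 / 2 - ν * (U x h) ^ 3 / 3 + (U x h) ^ 4 / 4 = h)
    (E : ℝ → ℝ)
    (hEdef : ∀ h, E h = ∫ y in (0:ℝ)..1,
      ((1 / 2) * (V y h + ((p h) ^ 2)⁻¹ * deriv^[2] (fun y' => V y' h) y) ^ 2
        + μ * (V y h) ^ 2 / 2 - ν * (V y h) ^ 3 / 3 + (V y h) ^ 4 / 4)) :
    ∀ h ∈ I, HasDerivAt E (-(deriv p h / p h) * (E h - h)) h := by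
  have hI : IsOpen I := hIdef ▸ isOpen_Ioo
  set S : Set (ℝ × ℝ) := univ ×ˢ I
  have hS : IsOpen S := isOpen_univ.prod hI
  have memS : ∀ y, ∀ h ∈ I, (y, h) ∈ S := fun y h hh => ⟨mem_univ y, hh⟩
  obtain ⟨D, hD⟩ : ∃ D : ℕ → ℝ × ℝ → ℝ, D 0 = (fun q => V q.1 q.2) ∧
      ∀ n, D (n + 1) = fun q => fderiv ℝ (D n) q (1, 0) :=
    ⟨fun n => Nat.rec (fun q => V q.1 q.2) (fun _ g q => fderiv ℝ g q (1, 0)) n, rfl, fun _ => rfl⟩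
  obtain ⟨hD0, hDs⟩ := hD
  have smD : ∀ n, ContDiffOn ℝ (⊤ : ℕ∞) (D n) S := by
    intro n
    induction n with
    | zero => rw [hD0]; exact hV
    | succ n ih => rw [hDs]; exact ih.fderiv_apply_of_isOpen hS _
  have perD : ∀ n, Function.Periodic (D n) (1, 0) := by
    intro n
    induction n with
    | zero => rw [hD0]; intro q; simpa using hVper q.1 q.2
    | succ n ih => rw [hDs]; exact fderiv_apply_periodic ih _
  -- `W n` is the mixed derivative `∂ₕ ∂ᵧⁿ V`.
  set W : ℕ → ℝ × ℝ → ℝ := fun n q => fderiv ℝ (D n) q (0, 1) with hW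
  have smW : ∀ n, ContDiffOn ℝ (⊤ : ℕ∞) (W n) S := fun n => (smD n).fderiv_apply_of_isOpen hS _
  have perW : ∀ n, Function.Periodic (W n) (1, 0) := fun n => fderiv_apply_periodic (perD n) _
  have hDy : ∀ n, ∀ h ∈ I, ∀ y, HasDerivAt (fun y => D n (y, h)) (D (n + 1) (y, h)) y := by
    intro n h hh y
    rw [hDs]
    exact (smD n).hasDerivAt_fst hS (memS y h hh)
  have hWy : ∀ n, ∀ h ∈ I, ∀ y, HasDerivAt (fun y => W n (y, h)) (W (n + 1) (y, h)) y := by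
    intro n h hh y
    refine ((smW n).hasDerivAt_fst hS (memS y h hh)).congr_deriv ?_
    simp only [hW, hDs n]
    exact (smD n).fderiv_fderiv_apply_comm hS (memS y h hh) _ _
  have hDh : ∀ n, ∀ h ∈ I, ∀ y, HasDerivAt (fun h => D n (y, h)) (W n (y, h)) h :=
    fun n h hh y => (smD n).hasDerivAt_snd hS (memS y h hh)
  have hVD : ∀ y h, V y h = D 0 (y, h) := fun y h => by rw [hD0]
  -- The two hypotheses on `U`, rewritten in terms of `V`.
  have hU : ∀ n, ∀ h ∈ I, deriv^[n] (fun x => U x h) =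
      fun x => (p h)⁻¹ ^ n * D n (x / p h, h) := by
    intro n h hh
    induction n with
    | zero => ext x; simp [hUdef, hVD]
    | succ n ih =>
      rw [Function.iterate_succ_apply', ih,
        deriv_const_mul_comp_div (k := fun y => D n (y, h)) (hDy n h hh)]
      ext x; ring
  have hVyy : ∀ h ∈ I, deriv^[2] (fun y => V y h) = fun y => D 2 (y, h) := by
    intro h hh
    have h0 : (fun y => V y h) = fun y => D 0 (y, h) := funext fun y => hVD y h
    have h1 : deriv (fun y => D 0 (y, h)) = fun y => D 1 (y, h) :=
      funext fun y => (hDy 0 h hh y).deriv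
    have h2 : deriv (fun y => D 1 (y, h)) = fun y => D 2 (y, h) :=
      funext fun y => (hDy 1 h hh y).deriv
    rw [h0, Function.iterate_succ_apply, Function.iterate_succ_apply, h1, h2]
    rfl
  have hU1 : ∀ h ∈ I, deriv (fun x => U x h) = fun x => (p h)⁻¹ * D 1 (x / p h, h) := by
    intro h hh
    simpa using hU 1 h hh
  have hSH' : ∀ h ∈ I, ∀ y, (p h)⁻¹ ^ 4 * D 4 (y, h) + 2 * ((p h)⁻¹ ^ 2 * D 2 (y, h))
      + (1 + μ) * D 0 (y, h) - ν * D 0 (y, h) ^ 2 + D 0 (y, h) ^ 3 = 0 := by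
    intro h hh y
    have := hSH h hh (y * p h)
    simp only [hU _ h hh] at this
    simpa only [hUdef, hVD, mul_div_cancel_right₀ y (hppos h hh).ne'] using this
  have hHam' : ∀ h ∈ I, ∀ y, ((p h)⁻¹ * D 1 (y, h)) * ((p h)⁻¹ ^ 3 * D 3 (y, h))
      - ((p h)⁻¹ ^ 2 * D 2 (y, h)) ^ 2 / 2 + ((p h)⁻¹ * D 1 (y, h)) ^ 2
      + D 0 (y, h) ^ 2 / 2 + μ * D 0 (y, h) ^ 2 / 2 - ν * D 0 (y, h) ^ 3 / 3
      + D 0 (y, h) ^ 4 / 4 = h := by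
    intro h hh y
    have := hHam h hh (y * p h)
    simp only [hU _ h hh, hU1 h hh] at this
    simpa only [hUdef, hVD, mul_div_cancel_right₀ y (hppos h hh).ne'] using this
  have hpd : ∀ h ∈ I, HasDerivAt p (deriv p h) h := fun h hh =>
    ((hp.contDiffAt (hI.mem_nhds hh)).differentiableAt (by simp)).hasDerivAt
  have hpc : ContinuousOn p I := hp.continuousOn
  have hp'c : ContinuousOn (deriv p) I := hp.continuousOn_deriv_of_isOpen hI (by simp)
  set r : ℝ → ℝ := fun h => (p h ^ 2)⁻¹ with hr
  set r' : ℝ → ℝ := fun h => -(2 * p h * deriv p h) / (p h ^ 2) ^ 2 with hr'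
  have hrd : ∀ h ∈ I, HasDerivAt r (r' h) h := fun h hh => by
    refine (((hpd h hh).pow 2).inv (pow_ne_zero 2 (hppos h hh).ne')).congr_deriv ?_
    simp [hr']
  have hsnd : MapsTo (Prod.snd : ℝ × ℝ → ℝ) S I := fun q hq => hq.2
  have hrc : ContinuousOn (fun q : ℝ × ℝ => r q.2) S :=
    ContinuousOn.comp (g := r) (t := I) (fun h hh => (hrd h hh).continuousAt.continuousWithinAt)
      continuousOn_snd hsnd
  have hr'c : ContinuousOn (fun q : ℝ × ℝ => r' q.2) S := by
    refine ContinuousOn.comp (g := r') (t := I) ?_ continuousOn_snd hsnd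
    exact ((continuousOn_const.mul hpc).mul hp'c).neg.div ((hpc.pow 2).pow 2)
      fun h hh => pow_ne_zero 2 (pow_ne_zero 2 (hppos h hh).ne')
  clear_value r r'
  have cD := fun n => (smD n).continuousOn
  have cW := fun n => (smW n).continuousOn
  set G : ℝ × ℝ → ℝ := fun q => (1 / 2) * (D 0 q + r q.2 * D 2 q) ^ 2
    + μ * D 0 q ^ 2 / 2 - ν * D 0 q ^ 3 / 3 + D 0 q ^ 4 / 4 with hG
  set G' : ℝ × ℝ → ℝ := fun q => (D 0 q + r q.2 * D 2 q) *
      (W 0 q + (r' q.2 * D 2 q + r q.2 * W 2 q))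
    + (μ * D 0 q - ν * D 0 q ^ 2 + D 0 q ^ 3) * W 0 q with hG'
  have cG : ContinuousOn G S :=
    (((continuousOn_const.mul (((cD 0).add (hrc.mul (cD 2))).pow 2)).add
      ((continuousOn_const.mul ((cD 0).pow 2)).div_const 2)).sub
      ((continuousOn_const.mul ((cD 0).pow 3)).div_const 3)).add (((cD 0).pow 4).div_const 4)
  have cG' : ContinuousOn G' S :=
    (((cD 0).add (hrc.mul (cD 2))).mul
      ((cW 0).add ((hr'c.mul (cD 2)).add (hrc.mul (cW 2))))).add
      ((((continuousOn_const.mul (cD 0)).sub (continuousOn_const.mul ((cD 0).pow 2))).add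
        ((cD 0).pow 3)).mul (cW 0))
  have hGd : ∀ y, ∀ h ∈ I, HasDerivAt (fun h => G (y, h)) (G' (y, h)) h := by
    intro y h hh
    have d0 := hDh 0 h hh y
    refine (((((d0.add ((hrd h hh).mul (hDh 2 h hh y))).pow 2).const_mul (1 / 2)).add
      (((d0.pow 2).const_mul μ).div_const 2)).sub (((d0.pow 3).const_mul ν).div_const 3)).add
      ((d0.pow 4).div_const 4) |>.congr_deriv ?_
    simp only [hG', Pi.add_apply, Pi.mul_apply]
    push_cast
    ring
  have hE : ∀ h ∈ I, E h = ∫ y in (0:ℝ)..1, G (y, h) := by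
    intro h hh
    rw [hEdef]
    simp only [hG, hr, hVyy h hh]
    simp only [hVD]
  intro h hh
  have hp0 : p h ≠ 0 := (hppos h hh).ne'
  set c : ℝ := -(deriv p h / p h) with hc
  refine ((hasDerivAt_intervalIntegral_of_continuousOn hI cG cG' hGd 0 1 hh).congr_of_eventuallyEq
    (Filter.eventually_of_mem (hI.mem_nhds hh) hE)).congr_deriv ?_
  -- The `h`-derivative of the energy density is `c * (G - h)` up to a `y`-derivative.
  set Φ : ℝ → ℝ := fun y =>
    r h * ((D 0 (y, h) + r h * D 2 (y, h)) * W 1 (y, h)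
      - (D 1 (y, h) + r h * D 3 (y, h)) * W 0 (y, h))
    + c * (r h * (D 0 (y, h) * D 1 (y, h)) + r h ^ 2 * (D 1 (y, h) * D 2 (y, h))) with hΦ
  have hΦd : ∀ y, HasDerivAt Φ (G' (y, h) - c * (G (y, h) - h)) y := by
    intro y
    have d := fun n => hDy n h hh y
    have w := fun n => hWy n h hh y
    refine ((((((d 0).add ((d 2).const_mul (r h))).mul (w 1)).sub
      (((d 1).add ((d 3).const_mul (r h))).mul (w 0))).const_mul (r h)).add
      (((((d 0).mul (d 1)).const_mul (r h)).add
        (((d 1).mul (d 2)).const_mul (r h ^ 2))).const_mul c)).congr_deriv ?_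
    have e1 := hSH' h hh y
    have e2 := hHam' h hh y
    have hrq : r h = (p h)⁻¹ ^ 2 := by simp [hr]
    have hr'q : r' h = 2 * c * (p h)⁻¹ ^ 2 := by
      simp only [hr', hc]
      field_simp
    simp only [hG, hG', hrq, hr'q, Pi.add_apply]
    linear_combination (-W 0 (y, h)) * e1 + c * e2
  have cGh : Continuous fun y => G (y, h) :=
    cG.comp_continuous (by fun_prop) fun y => memS y h hh
  have cGh' : Continuous fun y => G' (y, h) :=
    cG'.comp_continuous (by fun_prop) fun y => memS y h hh
  have cdiff : Continuous fun y => c * (G (y, h) - h) :=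
    continuous_const.mul (cGh.sub continuous_const)
  have hint := intervalIntegral.integral_eq_sub_of_hasDerivAt (a := 0) (b := 1)
    (fun y _ => hΦd y)
    ((cGh'.sub cdiff).intervalIntegrable _ _)
  have hΦper : Φ 1 = Φ 0 := by
    have d : ∀ n, D n (1, h) = D n (0, h) := fun n => by simpa using perD n (0, h)
    have w : ∀ n, W n (1, h) = W n (0, h) := fun n => by simpa using perW n (0, h)
    simp only [hΦ, d, w]
  rw [intervalIntegral.integral_sub (cGh'.intervalIntegrable _ _)
      (cdiff.intervalIntegrable _ _),
    intervalIntegral.integral_const_mul, intervalIntegral.integral_sub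
      (cGh.intervalIntegrable _ _) intervalIntegrable_const, hΦper, ← hE h hh] at hint
  simp only [intervalIntegral.integral_const, sub_zero, one_smul, sub_self] at hint
  linarith
end

section
/- Let ν ∈ ℝ, h ∈ ℝ, let J ⊂ ℝ be an open interval, let V : ℝ × J → ℝ be smooth with V(y+1,μ) = V(y,μ) for all (y,μ), and let p : J → (0,∞) be smooth. Define U(x,μ) := V(x/p(μ), μ) and assume that for each μ ∈ J: (a) U(·,μ) satisfies U'''' + 2U'' + (1+μ)U − νU² + U³ = 0 (derivatives in x), and (b) the pointwise identity U_x U_xxx − U_xx²/2 + U_x² + U²/2 + μU²/2 − νU³/3 + U⁴/4 = h holds for all x. Define E(μ) := ∫₀¹ [ (1/2)(V(y,μ) + p(μ)⁻²·V_yy(y,μ))² + μV(y,μ)²/2 − νV(y,μ)³/3 + V(y,μ)⁴/4 ] dy. Then E is differentiable and E'(μ) = (1/p(μ))∫₀^{p(μ)} U(x,μ)²/2 dx − (p'(μ)/p(μ))·(E(μ) − h). In particular, if μ* ∈ J satisfies E(μ*) = h and U(·,μ*) is not identically zero, then E'(μ*) > 0. -/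
open Set Filter Topology MeasureTheory

/-- The derivative of `f : ℝ × ℝ → ℝ` in the direction `v`. -/
noncomputable def dirDeriv (v : ℝ × ℝ) (f : ℝ × ℝ → ℝ) (q : ℝ × ℝ) : ℝ :=
  fderiv ℝ f q v

section DirDeriv

variable {f g : ℝ × ℝ → ℝ} {S : Set (ℝ × ℝ)} {J : Set ℝ}

lemma ContDiffOn.dirDeriv (hf : ContDiffOn ℝ (⊤ : ℕ∞) f S) (hS : IsOpen S) (v : ℝ × ℝ) :
    ContDiffOn ℝ (⊤ : ℕ∞) (dirDeriv v f) S :=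
  (hf.fderiv_of_isOpen hS (by simp)).clm_apply contDiffOn_const

lemma ContDiffOn.differentiableAt_of_isOpen (hf : ContDiffOn ℝ (⊤ : ℕ∞) f S) (hS : IsOpen S)
    {q : ℝ × ℝ} (hq : q ∈ S) : DifferentiableAt ℝ f q :=
  (hf.contDiffAt (hS.mem_nhds hq)).differentiableAt (by simp)

lemma DifferentiableAt.hasDerivAt_fst {y μ : ℝ} (hf : DifferentiableAt ℝ f (y, μ)) :
    HasDerivAt (fun y' => f (y', μ)) (_root_.dirDeriv (1, 0) f (y, μ)) y :=
  hf.hasFDerivAt.comp_hasDerivAt y ((hasDerivAt_id y).prodMk (hasDerivAt_const y μ))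

lemma DifferentiableAt.hasDerivAt_snd {y μ : ℝ} (hf : DifferentiableAt ℝ f (y, μ)) :
    HasDerivAt (fun μ' => f (y, μ')) (_root_.dirDeriv (0, 1) f (y, μ)) μ :=
  hf.hasFDerivAt.comp_hasDerivAt μ ((hasDerivAt_const μ y).prodMk (hasDerivAt_id μ))

lemma dirDeriv_add_period {c : ℝ × ℝ} (hf : ∀ q, f (q + c) = f q) (v q : ℝ × ℝ) :
    dirDeriv v f (q + c) = dirDeriv v f q := by
  simp only [dirDeriv]
  rw [← fderiv_comp_add_right, funext hf]

lemma dirDeriv_congr_of_isOpen (hS : IsOpen S) (hfg : ∀ q ∈ S, f q = g q) (v : ℝ × ℝ)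
    {q : ℝ × ℝ} (hq : q ∈ S) : dirDeriv v f q = dirDeriv v g q := by
  have h : f =ᶠ[𝓝 q] g := by
    filter_upwards [hS.mem_nhds hq] with r hr using hfg r hr
  simp only [dirDeriv, h.fderiv_eq]

lemma dirDeriv_comm (hf : ContDiffOn ℝ (⊤ : ℕ∞) f S) (hS : IsOpen S) (v w : ℝ × ℝ)
    {q : ℝ × ℝ} (hq : q ∈ S) :
    dirDeriv v (dirDeriv w f) q = dirDeriv w (dirDeriv v f) q := by
  have hd : DifferentiableAt ℝ (fderiv ℝ f) q :=
    ((hf.fderiv_of_isOpen hS (m := (⊤ : ℕ∞)) (by simp)).contDiffAt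
      (hS.mem_nhds hq)).differentiableAt (by simp)
  have hs : IsSymmSndFDerivAt ℝ f q :=
    (hf.contDiffAt (hS.mem_nhds hq)).isSymmSndFDerivAt (by
      simpa using WithTop.coe_le_coe.2 (le_top : (2 : ℕ∞) ≤ ⊤))
  have key : ∀ u t : ℝ × ℝ, dirDeriv u (dirDeriv t f) q = fderiv ℝ (fderiv ℝ f) q u t := by
    intro u t
    have h := (hd.hasFDerivAt.clm_apply (hasFDerivAt_const t q)).fderiv
    change fderiv ℝ (fun r => fderiv ℝ f r t) q u = _
    rw [h]
    simp
  rw [key, key, hs v w]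

/-- Differentiation under the integral sign over `[a, b]` for a smooth integrand. -/
lemma hasDerivAt_intervalIntegral_of_contDiffOn (hJ : IsOpen J)
    (hf : ContDiffOn ℝ (⊤ : ℕ∞) f (univ ×ˢ J)) (a b : ℝ) {μ : ℝ} (hμ : μ ∈ J) :
    HasDerivAt (fun μ' => ∫ y in a..b, f (y, μ')) (∫ y in a..b, dirDeriv (0, 1) f (y, μ)) μ := by
  have hS : IsOpen ((univ : Set ℝ) ×ˢ J) := isOpen_univ.prod hJ
  have hcont : ∀ g : ℝ × ℝ → ℝ, ContinuousOn g (univ ×ˢ J) → ∀ μ' ∈ J,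
      Continuous fun y => g (y, μ') := fun g hg μ' hμ' =>
    hg.comp_continuous (by fun_prop) fun y => ⟨mem_univ y, hμ'⟩
  have hg := (hf.dirDeriv hS (0, 1)).continuousOn
  obtain ⟨ε, hε, hεJ⟩ := Metric.nhds_basis_closedBall.mem_iff.1 (hJ.mem_nhds hμ)
  obtain ⟨C, hC⟩ := (isCompact_uIcc.prod (isCompact_closedBall μ ε)).exists_bound_of_continuousOn
    (hg.mono (prod_mono (subset_univ (uIcc a b)) hεJ))
  refine (intervalIntegral.hasDerivAt_integral_of_dominated_loc_of_deriv_le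
    (F := fun μ' y => f (y, μ')) (F' := fun μ' y => dirDeriv (0, 1) f (y, μ'))
    (bound := fun _ => C) (Metric.closedBall_mem_nhds μ hε) ?_ ?_ ?_ ?_ ?_ ?_).2
  · filter_upwards [hJ.mem_nhds hμ] with μ' hμ'
    exact (hcont f hf.continuousOn μ' hμ').aestronglyMeasurable
  · exact (hcont f hf.continuousOn μ hμ).intervalIntegrable a b
  · exact (hcont _ hg μ hμ).aestronglyMeasurable
  · exact .of_forall fun y hy μ' hμ' => hC (y, μ') ⟨uIoc_subset_uIcc hy, hμ'⟩
  · exact intervalIntegrable_const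
  · exact .of_forall fun y _ μ' hμ' =>
      (hf.differentiableAt_of_isOpen hS ⟨mem_univ y, hεJ hμ'⟩).hasDerivAt_snd

end DirDeriv

lemma iterate_deriv_eq_of_hasDerivAt {F : ℕ → ℝ → ℝ}
    (hF : ∀ n x, HasDerivAt (F n) (F (n + 1) x) x) (n : ℕ) : deriv^[n] (F 0) = F n := by
  induction n with
  | zero => rfl
  | succ n ih =>
    rw [Function.iterate_succ_apply', ih]
    exact funext fun x => (hF n x).deriv


/-- Derivative of the averaged Swift–Hohenberg PDE energy with respect to the
parameter `μ`: `E'(μ) = (1/p)∫₀^p U²/2 − (p'(μ)/p(μ))·(E(μ) − h)`; in particular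
`E'(μ*) > 0` at any `μ*` with `E(μ*) = h` and `U(·,μ*)` not identically zero. -/
theorem stmt_3 (ν h a b : ℝ) (J : Set ℝ) (hJdef : J = Set.Ioo a b)
    (V : ℝ → ℝ → ℝ)
    (hV : ContDiffOn ℝ (⊤ : ℕ∞) (fun q : ℝ × ℝ => V q.1 q.2) (Set.univ ×ˢ J))
    (hVper : ∀ y μ, V (y + 1) μ = V y μ)
    (p : ℝ → ℝ) (hp : ContDiffOn ℝ (⊤ : ℕ∞) p J) (hppos : ∀ μ ∈ J, 0 < p μ)
    (U : ℝ → ℝ → ℝ) (hUdef : ∀ x μ, U x μ = V (x / p μ) μ)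
    (hSH : ∀ μ ∈ J, ∀ x : ℝ,
      deriv^[4] (fun x' => U x' μ) x + 2 * deriv^[2] (fun x' => U x' μ) x
        + (1 + μ) * U x μ - ν * (U x μ) ^ 2 + (U x μ) ^ 3 = 0)
    (hHam : ∀ μ ∈ J, ∀ x : ℝ,
      deriv (fun x' => U x' μ) x * deriv^[3] (fun x' => U x' μ) x
        - (deriv^[2] (fun x' => U x' μ) x) ^ 2 / 2 + (deriv (fun x' => U x' μ) x) ^ 2
        + (U x μ) ^ 2 / 2 + μ * (U x μ) ^ 2 / 2 - ν * (U x μ) ^ 3 / 3 + (U x μ) ^ 4 / 4 = h)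
    (E : ℝ → ℝ)
    (hEdef : ∀ μ, E μ = ∫ y in (0:ℝ)..1,
      ((1 / 2) * (V y μ + ((p μ) ^ 2)⁻¹ * deriv^[2] (fun y' => V y' μ) y) ^ 2
        + μ * (V y μ) ^ 2 / 2 - ν * (V y μ) ^ 3 / 3 + (V y μ) ^ 4 / 4)) :
    (∀ μ ∈ J, HasDerivAt E
      ((1 / p μ) * (∫ x in (0:ℝ)..(p μ), (U x μ) ^ 2 / 2)
        - (deriv p μ / p μ) * (E μ - h)) μ)
    ∧ (∀ μstar ∈ J, E μstar = h → (∃ x : ℝ, U x μstar ≠ 0) → 0 < deriv E μstar) := by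
  have hJ : IsOpen J := hJdef ▸ isOpen_Ioo
  have hS : IsOpen ((univ : Set ℝ) ×ˢ J) := isOpen_univ.prod hJ
  set f : ℝ × ℝ → ℝ := fun q => V q.1 q.2 with hf
  have hmem : ∀ {μ}, μ ∈ J → ∀ y : ℝ, (y, μ) ∈ (univ : Set ℝ) ×ˢ J := fun hμ y => ⟨mem_univ y, hμ⟩
  -- the iterated `y`-derivatives of `V`
  set D : ℕ → ℝ × ℝ → ℝ := fun n => (dirDeriv (1, 0))^[n] f with hD
  have hDsucc : ∀ n, D (n + 1) = dirDeriv (1, 0) (D n) := fun n =>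
    Function.iterate_succ_apply' _ _ _
  have hDsmooth : ∀ n, ContDiffOn ℝ (⊤ : ℕ∞) (D n) (univ ×ˢ J) := by
    intro n
    induction n with
    | zero => exact hV
    | succ n ih => rw [hDsucc]; exact ih.dirDeriv hS _
  have hDper : ∀ n q, D n (q + (1, 0)) = D n q := by
    intro n
    induction n with
    | zero => intro q; simpa [hD, hf] using hVper q.1 q.2
    | succ n ih => rw [hDsucc]; exact dirDeriv_add_period ih _
  have hDy : ∀ n, ∀ μ ∈ J, ∀ y, HasDerivAt (fun y' => D n (y', μ)) (D (n + 1) (y, μ)) y := by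
    intro n μ hμ y
    rw [hDsucc]
    exact ((hDsmooth n).differentiableAt_of_isOpen hS (hmem hμ y)).hasDerivAt_fst
  have hViter : ∀ μ ∈ J, ∀ n y, deriv^[n] (fun y' => V y' μ) y = D n (y, μ) := fun μ hμ n y =>
    congrFun (iterate_deriv_eq_of_hasDerivAt (F := fun n y' => D n (y', μ))
      (fun n y => hDy n μ hμ y) n) y
  have hUiter : ∀ μ ∈ J, ∀ n y,
      deriv^[n] (fun x => U x μ) (y * p μ) = (p μ)⁻¹ ^ n * D n (y, μ) := by
    intro μ hμ n y
    have h0 : (fun x => U x μ) = fun x => (p μ)⁻¹ ^ 0 * D 0 (x / p μ, μ) := by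
      funext x; simp [hUdef, hD, hf]
    rw [h0, iterate_deriv_eq_of_hasDerivAt (F := fun n x => (p μ)⁻¹ ^ n * D n (x / p μ, μ))]
    · simp only [mul_div_cancel_right₀ y (hppos μ hμ).ne']
    · intro n x
      have h1 := ((hDy n μ hμ (x / p μ)).comp x ((hasDerivAt_id x).div_const (p μ))).const_mul
        ((p μ)⁻¹ ^ n)
      refine h1.congr_deriv ?_
      rw [pow_succ, one_div]
      ring
  -- the `μ`-derivative of `V` and its `y`-derivatives
  set W : ℕ → ℝ × ℝ → ℝ := fun n => dirDeriv (0, 1) (D n) with hW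
  have hWy : ∀ n, ∀ μ ∈ J, ∀ y, HasDerivAt (fun y' => W n (y', μ)) (W (n + 1) (y, μ)) y := by
    intro n μ hμ y
    have h := (((hDsmooth n).dirDeriv hS (0, 1)).differentiableAt_of_isOpen hS
      (hmem hμ y)).hasDerivAt_fst
    rwa [dirDeriv_comm (hDsmooth n) hS _ _ (hmem hμ y), ← hDsucc] at h
  have hWμ : ∀ n, ∀ μ ∈ J, ∀ y, HasDerivAt (fun μ' => D n (y, μ')) (W n (y, μ)) μ :=
    fun n μ hμ y => ((hDsmooth n).differentiableAt_of_isOpen hS (hmem hμ y)).hasDerivAt_snd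
  have hWper : ∀ n q, W n (q + (1, 0)) = W n q := fun n => dirDeriv_add_period (hDper n) _
  have hDc : ∀ n, ∀ μ ∈ J, Continuous fun y => D n (y, μ) := fun n μ hμ =>
    continuous_iff_continuousAt.2 fun y => (hDy n μ hμ y).continuousAt
  -- the energy density
  set e : ℝ × ℝ → ℝ := fun q => (1 / 2) * (D 0 q + ((p q.2) ^ 2)⁻¹ * D 2 q) ^ 2
        + q.2 * (D 0 q) ^ 2 / 2 - ν * (D 0 q) ^ 3 / 3 + (D 0 q) ^ 4 / 4 with he
  have hesmooth : ContDiffOn ℝ (⊤ : ℕ∞) e (univ ×ˢ J) := by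
    have hp2 : ContDiffOn ℝ (⊤ : ℕ∞) (fun q : ℝ × ℝ => ((p q.2) ^ 2)⁻¹) (univ ×ˢ J) :=
      ((hp.comp contDiffOn_snd fun q hq => hq.2).pow 2).inv fun q hq =>
        pow_ne_zero 2 (hppos q.2 hq.2).ne'
    have h0 := hDsmooth 0
    have h2 := hDsmooth 2
    have hs : ContDiffOn ℝ (⊤ : ℕ∞) (fun q : ℝ × ℝ => q.2) (univ ×ˢ J) := contDiffOn_snd
    exact (((contDiffOn_const.mul ((h0.add (hp2.mul h2)).pow 2)).add
      ((hs.mul (h0.pow 2)).div_const 2)).sub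
      ((contDiffOn_const.mul (h0.pow 3)).div_const 3)).add ((h0.pow 4).div_const 4)
  have hE : ∀ μ ∈ J, E μ = ∫ y in (0:ℝ)..1, e (y, μ) := by
    intro μ hμ
    rw [hEdef]
    refine intervalIntegral.integral_congr fun y _ => ?_
    simp only [hViter μ hμ 2, he]
    rfl
  have hUint : ∀ μ ∈ J, (1 / p μ) * (∫ x in (0:ℝ)..(p μ), (U x μ) ^ 2 / 2)
      = ∫ y in (0:ℝ)..1, (D 0 (y, μ)) ^ 2 / 2 := by
    intro μ hμ
    have hne := (hppos μ hμ).ne'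
    have h := intervalIntegral.integral_comp_div (a := 0) (b := p μ)
      (fun y => (V y μ) ^ 2 / 2) hne
    simp only [hUdef]
    rw [h, zero_div, div_self hne, smul_eq_mul, ← mul_assoc, one_div_mul_cancel hne, one_mul]
    rfl
  have hmain : ∀ μ ∈ J, HasDerivAt E
      ((1 / p μ) * (∫ x in (0:ℝ)..(p μ), (U x μ) ^ 2 / 2)
        - (deriv p μ / p μ) * (E μ - h)) μ := by
    intro μ hμ
    have hne := (hppos μ hμ).ne'
    have hpd : HasDerivAt p (deriv p μ) μ :=
      ((hp.contDiffAt (hJ.mem_nhds hμ)).differentiableAt (by simp)).hasDerivAt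
    have hder := hasDerivAt_intervalIntegral_of_contDiffOn hJ hesmooth 0 1 hμ
    have hEe : E =ᶠ[𝓝 μ] fun μ' => ∫ y in (0:ℝ)..1, e (y, μ') := by
      filter_upwards [hJ.mem_nhds hμ] with μ' hμ' using hE μ' hμ'
    refine (hder.congr_of_eventuallyEq hEe).congr_deriv ?_
    have hec : Continuous fun y => e (y, μ) :=
      hesmooth.continuousOn.comp_continuous (by fun_prop) (hmem hμ)
    have hdec : Continuous fun y => dirDeriv (0, 1) e (y, μ) :=
      (hesmooth.dirDeriv hS (0, 1)).continuousOn.comp_continuous (by fun_prop) (hmem hμ)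
    have hv2c : Continuous fun y => (D 0 (y, μ)) ^ 2 / 2 := ((hDc 0 μ hμ).pow 2).div_const 2
    have hEh : E μ - h = ∫ y in (0:ℝ)..1, (e (y, μ) - h) := by
      rw [intervalIntegral.integral_sub (hec.intervalIntegrable _ _) intervalIntegrable_const,
        hE μ hμ]
      simp
    have hR : Continuous fun y => deriv p μ / p μ * (e (y, μ) - h) :=
      continuous_const.mul (hec.sub continuous_const)
    have hQ : Continuous fun y => (D 0 (y, μ)) ^ 2 / 2 - deriv p μ / p μ * (e (y, μ) - h) :=
      hv2c.sub hR
    rw [hUint μ hμ, hEh, ← intervalIntegral.integral_const_mul,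
      ← intervalIntegral.integral_sub (hv2c.intervalIntegrable _ _) (hR.intervalIntegrable _ _),
      ← sub_eq_zero, ← intervalIntegral.integral_sub (hdec.intervalIntegrable _ _)
        (hQ.intervalIntegrable _ _)]
    -- the remaining integrand is the derivative of a `1`-periodic function
    set k := (p μ)⁻¹ with hk
    set c := deriv p μ with hc
    set G : ℝ → ℝ := fun y =>
      k ^ 2 * (D 0 (y, μ) * W 1 (y, μ) - D 1 (y, μ) * W 0 (y, μ))
      + k ^ 4 * (D 2 (y, μ) * W 1 (y, μ) - D 3 (y, μ) * W 0 (y, μ))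
      - c * k ^ 3 * (D 0 (y, μ) * D 1 (y, μ) + k ^ 2 * (D 1 (y, μ) * D 2 (y, μ))) with hG
    have hGd : ∀ y, HasDerivAt G (dirDeriv (0, 1) e (y, μ)
        - ((D 0 (y, μ)) ^ 2 / 2 - c / p μ * (e (y, μ) - h))) y := by
      intro y
      have d0 := hDy 0 μ hμ y
      have d1 := hDy 1 μ hμ y
      have d2 := hDy 2 μ hμ y
      have d3 := hDy 3 μ hμ y
      have w0 := hWy 0 μ hμ y
      have w1 := hWy 1 μ hμ y
      have hd := ((((d0.mul w1).sub (d1.mul w0)).const_mul (k ^ 2)).add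
        (((d2.mul w1).sub (d3.mul w0)).const_mul (k ^ 4))).sub
        (((d0.mul d1).add ((d1.mul d2).const_mul (k ^ 2))).const_mul (c * k ^ 3))
      refine hd.congr_deriv ?_
      have m0 := hWμ 0 μ hμ y
      have m2 := hWμ 2 μ hμ y
      have hk2 : HasDerivAt (fun μ' => ((p μ') ^ 2)⁻¹) (-2 * c * k ^ 3) μ := by
        refine ((hpd.pow 2).inv (pow_ne_zero 2 hne)).congr_deriv ?_
        rw [hk]
        simp
        field_simp
      have hed := (((((m0.add (hk2.mul m2)).pow 2).const_mul (1 / 2)).add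
        (((hasDerivAt_id μ).mul (m0.pow 2)).div_const 2)).sub
        (((m0.pow 3).const_mul ν).div_const 3)).add ((m0.pow 4).div_const 4)
      have hE' := ((hesmooth.differentiableAt_of_isOpen hS
        (hmem hμ y)).hasDerivAt_snd).unique hed
      have hsh := hSH μ hμ (y * p μ)
      have hham := hHam μ hμ (y * p μ)
      have u0 := hUiter μ hμ 0 y
      have u1 := hUiter μ hμ 1 y
      simp only [Function.iterate_zero, id, Function.iterate_one] at u0 u1
      rw [hUiter μ hμ 4, hUiter μ hμ 2, u0] at hsh
      rw [hUiter μ hμ 3, hUiter μ hμ 2, u1, u0] at hham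
      have hpk : ((p μ) ^ 2)⁻¹ = k ^ 2 := by rw [hk, inv_pow]
      have hck : c / p μ = c * k := div_eq_mul_inv _ _
      rw [hE', hck]
      simp [he, hpk]
      linear_combination (-W 0 (y, μ)) * hsh - c * k * hham
    have hGc : Continuous fun y => dirDeriv (0, 1) e (y, μ)
        - ((D 0 (y, μ)) ^ 2 / 2 - c / p μ * (e (y, μ) - h)) := hdec.sub hQ
    rw [intervalIntegral.integral_eq_sub_of_hasDerivAt (fun y _ => hGd y)
      (hGc.intervalIntegrable _ _)]
    have d1 : ∀ n, D n (1, μ) = D n (0, μ) := fun n => by simpa using hDper n (0, μ)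
    have w1 : ∀ n, W n (1, μ) = W n (0, μ) := fun n => by simpa using hWper n (0, μ)
    simp only [hG, d1, w1, sub_self]
  refine ⟨hmain, fun μ hμ hEμ ⟨x, hx⟩ => ?_⟩
  rw [(hmain μ hμ).deriv, hEμ, sub_self, mul_zero, sub_zero, hUint μ hμ]
  have hper : Function.Periodic (fun y => V y μ) 1 := fun y => hVper y μ
  obtain ⟨y, hy, hxy⟩ := hper.exists_mem_Ico₀ one_pos (x / p μ)
  refine intervalIntegral.integral_pos one_pos
    (((hDc 0 μ hμ).pow 2).div_const 2).continuousOn (fun y _ => by positivity)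
    ⟨y, Ico_subset_Icc_self hy, ?_⟩
  have hVy : D 0 (y, μ) ≠ 0 := by
    rw [hUdef] at hx
    exact fun h0 => hx (hxy.trans h0)
  positivity
end

section
/- Let μ, ν ∈ ℝ, ε ≥ 0, let 0 < a < b ≤ ∞, and let u = (u₁,u₂,u₃,u₄) : (a,b) → ℝ⁴ be a differentiable solution of the Swift–Hohenberg first-order radial system u₁' = u₂, u₂' = u₃ − u₁ − (ε/r)u₂, u₃' = u₄, u₄' = −u₃ − μu₁ + νu₁² − u₁³ − (ε/r)u₄. Then the function r ↦ H(u(r),μ) is differentiable on (a,b) and (d/dr) H(u(r),μ) = −(2ε/r)·u₂(r)·u₄(r) for all r ∈ (a,b). In particular, if ε = 0 then H(u(r),μ) is constant on (a,b). -/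
/-- Along any solution of the Swift–Hohenberg first-order radial system, the
quantity `H(u(r),μ)` satisfies `(d/dr)H = −(2ε/r)·u₂·u₄`; in particular `H` is
constant when `ε = 0`. -/
theorem stmt_4 (μ ν ε : ℝ) (hε : 0 ≤ ε) (a : ℝ) (b : EReal)
    (ha : 0 < a) (hab : (a : EReal) < b)
    (S : Set ℝ) (hS : S = {r : ℝ | a < r ∧ (r : EReal) < b})
    (u₁ u₂ u₃ u₄ : ℝ → ℝ)
    (h₁ : ∀ r ∈ S, HasDerivAt u₁ (u₂ r) r)
    (h₂ : ∀ r ∈ S, HasDerivAt u₂ (u₃ r - u₁ r - (ε / r) * u₂ r) r)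
    (h₃ : ∀ r ∈ S, HasDerivAt u₃ (u₄ r) r)
    (h₄ : ∀ r ∈ S, HasDerivAt u₄
      (-(u₃ r) - μ * u₁ r + ν * (u₁ r) ^ 2 - (u₁ r) ^ 3 - (ε / r) * u₄ r) r) :
    (∀ r ∈ S, HasDerivAt (fun r' =>
        u₂ r' * u₄ r' + u₁ r' * u₃ r' - (u₃ r') ^ 2 / 2 + μ * (u₁ r') ^ 2 / 2
          - ν * (u₁ r') ^ 3 / 3 + (u₁ r') ^ 4 / 4)
      (-(2 * ε / r) * (u₂ r * u₄ r)) r)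
    ∧ (ε = 0 → ∀ r ∈ S, ∀ r' ∈ S,
        u₂ r * u₄ r + u₁ r * u₃ r - (u₃ r) ^ 2 / 2 + μ * (u₁ r) ^ 2 / 2
          - ν * (u₁ r) ^ 3 / 3 + (u₁ r) ^ 4 / 4
        = u₂ r' * u₄ r' + u₁ r' * u₃ r' - (u₃ r') ^ 2 / 2 + μ * (u₁ r') ^ 2 / 2
          - ν * (u₁ r') ^ 3 / 3 + (u₁ r') ^ 4 / 4) := by
  have hderiv : ∀ r ∈ S, HasDerivAt (fun r' =>
      u₂ r' * u₄ r' + u₁ r' * u₃ r' - (u₃ r') ^ 2 / 2 + μ * (u₁ r') ^ 2 / 2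
        - ν * (u₁ r') ^ 3 / 3 + (u₁ r') ^ 4 / 4)
      (-(2 * ε / r) * (u₂ r * u₄ r)) r := by
    intro r hr
    have H := ((((((h₂ r hr).fun_mul (h₄ r hr)).fun_add ((h₁ r hr).fun_mul (h₃ r hr))).fun_sub
      (((h₃ r hr).fun_pow 2).div_const 2)).fun_add
      ((((h₁ r hr).fun_pow 2).const_mul μ).div_const 2)).fun_sub
      ((((h₁ r hr).fun_pow 3).const_mul ν).div_const 3)).fun_add
      (((h₁ r hr).fun_pow 4).div_const 4)
    refine H.congr_deriv ?_
    push_cast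
    ring
  refine ⟨hderiv, fun hε0 r hr r' hr' => ?_⟩
  have hconv : Convex ℝ S := by
    refine Set.OrdConnected.convex ⟨?_⟩
    subst hS
    intro x hx y hy z hz
    exact ⟨hx.1.trans_le hz.1, (EReal.coe_le_coe_iff.2 hz.2).trans_lt hy.2⟩
  have hopen : IsOpen S := by
    subst hS
    exact (isOpen_lt continuous_const continuous_id).inter
      (isOpen_lt continuous_coe_real_ereal continuous_const)
  refine hopen.is_const_of_deriv_eq_zero hconv.isPreconnected
    (fun x hx => (hderiv x hx).differentiableAt.differentiableWithinAt)
    (fun x hx => ?_) hr hr'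
  rw [(hderiv x hx).deriv, hε0]
  simp
end

section
/- Let p > 0, M ≥ 0, m ≥ 1, and let F : ℝ × ℝ^m → ℝ be continuous, p-periodic in its first argument (F(t+p,w) = F(t,w) for all t, w), with ∫₀^p F(t,w) dt = 0 for every w ∈ ℝ^m and |F(t,w)| ≤ M for all (t,w). Then for every r₀ > 0 and every x ≥ r₀ and every w ∈ ℝ^m, the function W(x,w) := ∫_{r₀}^x F(s,w)/s ds satisfies |W(x,w)| ≤ 2pM/r₀. -/
open intervalIntegral in
/-- A primitive of a continuous periodic function with zero average is periodic. -/
theorem Function.Periodic.periodic_primitive_of_integral_eq_zero {f : ℝ → ℝ} {p : ℝ}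
    (hf : Continuous f) (hper : Function.Periodic f p) (havg : ∫ t in (0:ℝ)..p, f t = 0) (a : ℝ) :
    Function.Periodic (fun x => ∫ t in a..x, f t) p := fun x => by
  have h := hper.intervalIntegral_add_eq x 0
  rw [zero_add, havg] at h
  simp only
  rw [← integral_add_adjacent_intervals (hf.intervalIntegrable a x)
    (hf.intervalIntegrable x (x + p)), h, add_zero]

/-- A primitive of a continuous `p`-periodic function with zero average, bounded by `M`, is
bounded by `p * M`. -/
theorem Function.Periodic.abs_primitive_le {f : ℝ → ℝ} {p M : ℝ} (hp : 0 < p)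
    (hf : Continuous f) (hper : Function.Periodic f p) (havg : ∫ t in (0:ℝ)..p, f t = 0)
    (hbd : ∀ t, |f t| ≤ M) (a x : ℝ) : |∫ t in a..x, f t| ≤ p * M := by
  obtain ⟨y, ⟨hay, hyp⟩, hxy⟩ :=
    (hper.periodic_primitive_of_integral_eq_zero hf havg a).exists_mem_Ico hp x a
  have hM : 0 ≤ M := (abs_nonneg _).trans (hbd 0)
  calc |∫ t in a..x, f t| = ‖∫ t in a..y, f t‖ := congrArg abs hxy
    _ ≤ M * |y - a| := intervalIntegral.norm_integral_le_of_norm_le_const fun t _ => hbd t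
    _ ≤ M * p := by
      rw [abs_of_nonneg (sub_nonneg.2 hay)]
      gcongr
      linarith
    _ = p * M := mul_comm _ _

open intervalIntegral in
/-- If the primitives of `f` based at `a > 0` are bounded by `C`, then so are the integrals of
`f s / s`, by `C / a`. -/
theorem abs_integral_div_le_of_abs_primitive_le {f : ℝ → ℝ} {a x C : ℝ} (hf : Continuous f)
    (ha : 0 < a) (hax : a ≤ x) (hC : ∀ y, |∫ t in a..y, f t| ≤ C) :
    |∫ s in a..x, f s / s| ≤ C / a := by
  set G : ℝ → ℝ := fun y => ∫ t in a..y, f t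
  have hpos : ∀ s ∈ Set.uIcc a x, 0 < s := fun s hs => by
    rw [Set.uIcc_of_le hax] at hs
    exact ha.trans_le hs.1
  have hG' : ∀ y, HasDerivAt G (f y) y := fun y => hf.integral_hasStrictDerivAt a y |>.hasDerivAt
  have hinv : ∀ s ∈ Set.uIcc a x, HasDerivAt (fun s : ℝ => s⁻¹) (-(s ^ 2)⁻¹) s :=
    fun s hs => hasDerivAt_inv (hpos s hs).ne'
  have hsq : ContinuousOn (fun s : ℝ => (s ^ 2)⁻¹) (Set.uIcc a x) :=
    (continuous_pow 2).continuousOn.inv₀ fun s hs => (pow_pos (hpos s hs) 2).ne'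
  have hparts : ∫ s in a..x, f s / s = x⁻¹ * G x + ∫ s in a..x, (s ^ 2)⁻¹ * G s := by
    have h := integral_mul_deriv_eq_deriv_mul hinv (fun s _ => hG' s)
      hsq.neg.intervalIntegrable (hf.intervalIntegrable a x)
    have hGa : G a = 0 := integral_same
    simp only [neg_mul, integral_neg, hGa, mul_zero, sub_zero, sub_neg_eq_add] at h
    simpa only [div_eq_inv_mul] using h
  have hint : ∫ s in a..x, (s ^ 2)⁻¹ * C = (a⁻¹ - x⁻¹) * C := by
    have h := integral_eq_sub_of_hasDerivAt hinv hsq.neg.intervalIntegrable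
    rw [integral_neg] at h
    rw [integral_mul_const, show a⁻¹ - x⁻¹ = -(x⁻¹ - a⁻¹) by ring, ← h, neg_neg]
  have hle : |∫ s in a..x, (s ^ 2)⁻¹ * G s| ≤ (a⁻¹ - x⁻¹) * C := by
    rw [← hint, ← Real.norm_eq_abs]
    have hi : IntervalIntegrable (fun s : ℝ => (s ^ 2)⁻¹ * C) MeasureTheory.volume a x :=
      (hsq.mul continuousOn_const).intervalIntegrable
    refine norm_integral_le_of_norm_le hax (.of_forall fun s _ => ?_) hi
    rw [Real.norm_eq_abs, abs_mul, abs_of_nonneg (by positivity : 0 ≤ (s ^ 2)⁻¹)]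
    gcongr
    exact hC s
  have hx : 0 < x := ha.trans_le hax
  calc |∫ s in a..x, f s / s| ≤ |x⁻¹ * G x| + |∫ s in a..x, (s ^ 2)⁻¹ * G s| := by
        rw [hparts]
        exact abs_add_le _ _
    _ ≤ x⁻¹ * C + (a⁻¹ - x⁻¹) * C := by
        refine add_le_add ?_ hle
        rw [abs_mul, abs_of_pos (inv_pos.2 hx)]
        gcongr
        exact hC x
    _ = C / a := by ring

/-- Uniform boundedness of the averaging transformation: if `F` is continuous,
`p`-periodic with zero average in its first argument, and bounded by `M`, then
`W(x,w) = ∫_{r₀}^x F(s,w)/s ds` is bounded by `2pM/r₀` for all `x ≥ r₀`. -/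
theorem stmt_10 (p M : ℝ) (hp : 0 < p) (hM : 0 ≤ M) (m : ℕ) (hm : 1 ≤ m)
    (F : ℝ → (Fin m → ℝ) → ℝ)
    (hFcont : Continuous (fun q : ℝ × (Fin m → ℝ) => F q.1 q.2))
    (hFper : ∀ (t : ℝ) (w : Fin m → ℝ), F (t + p) w = F t w)
    (hFavg : ∀ w : Fin m → ℝ, (∫ t in (0:ℝ)..p, F t w) = 0)
    (hFbd : ∀ (t : ℝ) (w : Fin m → ℝ), |F t w| ≤ M) :
    ∀ r₀ > (0:ℝ), ∀ x ≥ r₀, ∀ w : Fin m → ℝ,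
      |∫ s in r₀..x, F s w / s| ≤ 2 * p * M / r₀ := by
  intro r₀ hr₀ x hx w
  have hf : Continuous fun t => F t w := hFcont.comp (by fun_prop : Continuous fun t => (t, w))
  have hper : Function.Periodic (fun t => F t w) p := fun t => hFper t w
  refine (abs_integral_div_le_of_abs_primitive_le hf hr₀ hx
    (hper.abs_primitive_le hp hf (hFavg w) (fun t => hFbd t w) r₀)).trans ?_
  have hpM : 0 ≤ p * M := mul_nonneg hp.le hM
  gcongr
  linarith
end

section
/- Let C₀ > 0, 0 < r₀ ≤ 1, and 0 < δ < k. Set b := (k−δ)/(2C₀) and ε₁ := (k−δ)/(2C₀·(1 + |ln r₀|)). Let 0 < ε ≤ ε₁, let r₀ < L ≤ exp(b/ε), and let v : [r₀,L] → ℝ be continuously differentiable with |v(L)| ≤ δ and |v'(x)| ≤ εC₀/x for all x ∈ [r₀,L]. Then |v(x)| ≤ k for all x ∈ [r₀,L]. -/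
/-- If `|f' x| ≤ c / x` on `[a, b]` with `0 < a`, then the increment of `f` is at most
`c * (log b - log a)`. -/
theorem abs_sub_le_mul_log_sub_log {f f' : ℝ → ℝ} {a b c : ℝ} (ha : 0 < a) (hab : a ≤ b)
    (hf : ∀ x ∈ Set.Icc a b, HasDerivAt f (f' x) x)
    (hbd : ∀ x ∈ Set.Icc a b, |f' x| ≤ c / x) :
    |f b - f a| ≤ c * (Real.log b - Real.log a) := by
  have hB : ∀ x ∈ Set.Icc a b,
      HasDerivAt (fun y => c * (Real.log y - Real.log a)) (c / x) x := fun x hx => by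
    simpa [div_eq_mul_inv] using
      ((Real.hasDerivAt_log (ha.trans_le hx.1).ne').sub_const (Real.log a)).const_mul c
  have hg : ∀ x ∈ Set.Icc a b, HasDerivAt (fun y => f y - f a) (f' x) x :=
    fun x hx => (hf x hx).sub_const _
  exact image_norm_le_of_norm_deriv_right_le_deriv_boundary'
    (f := fun y => f y - f a) (f' := f')
    (fun x hx => (hg x hx).continuousAt.continuousWithinAt)
    (fun x hx => (hg x (Set.Ico_subset_Icc_self hx)).hasDerivWithinAt)
    (by simp)
    (fun x hx => (hB x hx).continuousAt.continuousWithinAt)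
    (fun x hx => (hB x (Set.Ico_subset_Icc_self hx)).hasDerivWithinAt)
    (fun x hx => hbd x (Set.Ico_subset_Icc_self hx))
    (Set.right_mem_Icc.2 hab)

/-- Quantitative confinement: with `b = (k−δ)/(2C₀)` and
`ε₁ = (k−δ)/(2C₀(1+|ln r₀|))`, any `v` with `|v(L)| ≤ δ` and `|v'(x)| ≤ εC₀/x`
on `[r₀,L]` stays in `[−k,k]` provided `0 < ε ≤ ε₁` and `r₀ < L ≤ e^{b/ε}`. -/
theorem stmt_12 (C₀ r₀ δ k : ℝ) (hC₀ : 0 < C₀) (hr₀ : 0 < r₀) (hr₀1 : r₀ ≤ 1)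
    (hδ : 0 < δ) (hδk : δ < k)
    (b ε₁ : ℝ) (hb : b = (k - δ) / (2 * C₀))
    (hε₁ : ε₁ = (k - δ) / (2 * C₀ * (1 + |Real.log r₀|)))
    (ε L : ℝ) (hε : 0 < ε) (hεε₁ : ε ≤ ε₁) (hL1 : r₀ < L) (hL2 : L ≤ Real.exp (b / ε))
    (v v' : ℝ → ℝ)
    (hv : ∀ x ∈ Set.Icc r₀ L, HasDerivAt v (v' x) x)
    (hv'cont : ContinuousOn v' (Set.Icc r₀ L))
    (hvL : |v L| ≤ δ)
    (hbd : ∀ x ∈ Set.Icc r₀ L, |v' x| ≤ ε * C₀ / x) :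
    ∀ x ∈ Set.Icc r₀ L, |v x| ≤ k := by
  intro x hx
  have hx0 : 0 < x := hr₀.trans_le hx.1
  have hincr : |v L - v x| ≤ ε * C₀ * (Real.log L - Real.log x) :=
    abs_sub_le_mul_log_sub_log hx0 hx.2
      (fun y hy => hv y ⟨hx.1.trans hy.1, hy.2⟩) (fun y hy => hbd y ⟨hx.1.trans hy.1, hy.2⟩)
  have hlogL : Real.log L ≤ b / ε := (Real.log_le_iff_le_exp (hr₀.trans hL1)).2 hL2
  have hlogx : -|Real.log r₀| ≤ Real.log x :=
    (neg_abs_le _).trans (Real.log_le_log hr₀ hx.1)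
  have hfar : ε * C₀ * (b / ε) = (k - δ) / 2 := by
    rw [hb]
    field_simp
  have hnear : ε * C₀ * |Real.log r₀| ≤ (k - δ) / 2 := by
    have hpos : 0 < 2 * C₀ * (1 + |Real.log r₀|) := by positivity
    rw [hε₁, le_div_iff₀ hpos] at hεε₁
    linarith [mul_pos hε hC₀]
  have hbound : ε * C₀ * (Real.log L - Real.log x) ≤ ε * C₀ * (b / ε + |Real.log r₀|) := by
    gcongr
    linarith
  have htri : |v x| ≤ |v L| + |v L - v x| := by
    simpa using abs_sub (v L) (v L - v x)
  linarith
end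

section
/- Let 0 < r₀ < L, let ε, b > 0, k₊ > 0, and 0 ≤ δ ≤ k₊, and let w : [r₀,L] → ℝ be continuously differentiable such that w(L) ∈ [0,δ] and w'(x) ≤ −εb/x for every x ∈ [r₀,L] with w(x) ∈ [0,k₊]. If εb·ln(L/r₀) > k₊, then there exists y ∈ [r₀,L] with w(y) > k₊. -/
/-- Nonpersistence mechanism: if `w(L) ∈ [0,δ]`, `w'(x) ≤ −εb/x` whenever
`w(x) ∈ [0,kplus]`, and `εb ln(L/r₀) > kplus`, then `w` exceeds `kplus`
somewhere on `[r₀,L]`. -/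
theorem stmt_13 (r₀ L ε b kplus δ : ℝ) (hr₀ : 0 < r₀) (hrL : r₀ < L)
    (hε : 0 < ε) (hb : 0 < b) (hk : 0 < kplus) (hδ0 : 0 ≤ δ) (hδk : δ ≤ kplus)
    (w w' : ℝ → ℝ)
    (hw : ∀ x ∈ Set.Icc r₀ L, HasDerivAt w (w' x) x)
    (hw'cont : ContinuousOn w' (Set.Icc r₀ L))
    (hwL : w L ∈ Set.Icc 0 δ)
    (hdec : ∀ x ∈ Set.Icc r₀ L, w x ∈ Set.Icc 0 kplus → w' x ≤ -(ε * b) / x)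
    (hbig : kplus < ε * b * Real.log (L / r₀)) :
    ∃ y ∈ Set.Icc r₀ L, kplus < w y := by
  by_contra! hle
  have hL : 0 < L := hr₀.trans hrL
  have hlog : 0 < Real.log (L / r₀) := Real.log_pos ((one_lt_div hr₀).2 hrL)
  obtain ⟨c, hc, hcb⟩ := exists_between ((div_lt_iff₀ hlog).2 hbig)
  have hc0 : 0 < c := (div_pos hk hlog).trans hc
  have hmem : ∀ t ∈ Set.Icc 0 (L - r₀), L - t ∈ Set.Icc r₀ L := fun t ht =>
    ⟨by linarith [ht.2], by linarith [ht.1]⟩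
  have hf : ∀ t ∈ Set.Icc 0 (L - r₀), HasDerivAt (fun t => -w (L - t)) (w' (L - t)) t := by
    intro t ht
    exact ((hw _ (hmem t ht)).comp_const_sub L t).neg.congr_deriv (neg_neg _)
  have hB : ∀ t ∈ Set.Icc 0 (L - r₀),
      HasDerivAt (fun t => c * (Real.log (L - t) - Real.log L)) (-c / (L - t)) t := by
    intro t ht
    have hpos : 0 < L - t := hr₀.trans_le (hmem t ht).1
    exact ((((hasDerivAt_id t).const_sub L).log hpos.ne').sub_const (Real.log L)).const_mul c
      |>.congr_deriv (by simp only [id]; ring)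
  have key := image_le_of_deriv_right_lt_deriv_boundary'
    (fun t ht => (hf t ht).continuousAt.continuousWithinAt)
    (fun t ht => (hf t (Set.Ico_subset_Icc_self ht)).hasDerivWithinAt)
    (by simpa using hwL.1)
    (fun t ht => (hB t ht).continuousAt.continuousWithinAt)
    (fun t ht => (hB t (Set.Ico_subset_Icc_self ht)).hasDerivWithinAt)
    (fun t ht heq => by
      have hx := hmem t (Set.Ico_subset_Icc_self ht)
      have hpos : 0 < L - t := hr₀.trans_le hx.1
      have hlogle : Real.log (L - t) ≤ Real.log L := Real.log_le_log hpos hx.2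
      have hw0 : 0 ≤ w (L - t) := by nlinarith
      refine (hdec _ hx ⟨hw0, hle _ hx⟩).trans_lt ?_
      gcongr)
    (Set.right_mem_Icc.2 (sub_nonneg.2 hrL.le))
  have hwr := hle r₀ (Set.left_mem_Icc.2 hrL.le)
  rw [div_lt_iff₀ hlog, Real.log_div hL.ne' hr₀.ne'] at hc
  simp only [sub_sub_cancel] at key
  linarith
end

section
/- Let 0 < r₀ ≤ L, C₀ ≥ 0, ε ≥ 0, and let h₁ : ℝ × ℝ → ℝ and h₂ : [r₀,L] × ℝ × ℝ → ℝ be functions bounded in absolute value by C₀. Let (v^c, v^h) : [r₀,L] → ℝ² be continuously differentiable and satisfy (v^c)'(x) = 1 + (ε/x)·h₁(v^c(x),v^h(x)) + (ε²/x²)·h₂(x,v^c(x),v^h(x)) for all x ∈ [r₀,L], with v^c(L) = φ. Then |v^c(r₀) − (φ − L + r₀)| ≤ εC₀·ln(L/r₀) + ε²C₀·(1/r₀ − 1/L). -/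
/-- Phase-slip estimate on the perturbed invariant manifold: the center
coordinate `v^c` differs at `x = r₀` from the unperturbed drift `φ − L + r₀` by
at most `εC₀ ln(L/r₀) + ε²C₀(1/r₀ − 1/L)`. -/
theorem stmt_18 (r₀ L C₀ ε φ : ℝ) (hr₀ : 0 < r₀) (hrL : r₀ ≤ L)
    (hC₀ : 0 ≤ C₀) (hε : 0 ≤ ε)
    (h₁ : ℝ → ℝ → ℝ) (h₂ : ℝ → ℝ → ℝ → ℝ)
    (hb₁ : ∀ a b : ℝ, |h₁ a b| ≤ C₀)
    (hb₂ : ∀ x ∈ Set.Icc r₀ L, ∀ a b : ℝ, |h₂ x a b| ≤ C₀)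
    (vc vh vh' : ℝ → ℝ)
    (hvc : ∀ x ∈ Set.Icc r₀ L, HasDerivAt vc
      (1 + (ε / x) * h₁ (vc x) (vh x) + (ε ^ 2 / x ^ 2) * h₂ x (vc x) (vh x)) x)
    (hvccont : ContinuousOn (fun x => 1 + (ε / x) * h₁ (vc x) (vh x)
      + (ε ^ 2 / x ^ 2) * h₂ x (vc x) (vh x)) (Set.Icc r₀ L))
    (hvh : ∀ x ∈ Set.Icc r₀ L, HasDerivAt vh (vh' x) x)
    (hvh'cont : ContinuousOn vh' (Set.Icc r₀ L))
    (hφ : vc L = φ) :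
    |vc r₀ - (φ - L + r₀)| ≤ ε * C₀ * Real.log (L / r₀) + ε ^ 2 * C₀ * (1 / r₀ - 1 / L) := by
  have hpos : ∀ x ∈ Set.Icc r₀ L, 0 < x := fun x hx => hr₀.trans_le hx.1
  have hf : ∀ x ∈ Set.Icc r₀ L, HasDerivAt (fun y => vc y - vc r₀ - (y - r₀))
      ((ε / x) * h₁ (vc x) (vh x) + (ε ^ 2 / x ^ 2) * h₂ x (vc x) (vh x)) x := by
    intro x hx
    refine (((hvc x hx).sub_const (vc r₀)).sub ((hasDerivAt_id x).sub_const r₀)).congr_deriv ?_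
    ring
  have hB : ∀ x ∈ Set.Icc r₀ L, HasDerivAt
      (fun y => ε * C₀ * (Real.log y - Real.log r₀) + ε ^ 2 * C₀ * (r₀⁻¹ - y⁻¹))
      ((ε / x) * C₀ + (ε ^ 2 / x ^ 2) * C₀) x := by
    intro x hx
    have hx0 := (hpos x hx).ne'
    refine ((((Real.hasDerivAt_log hx0).sub_const (Real.log r₀)).const_mul (ε * C₀)).add
      (((hasDerivAt_inv hx0).const_sub r₀⁻¹).const_mul (ε ^ 2 * C₀))).congr_deriv ?_
    field_simp
  have bound := image_norm_le_of_norm_deriv_right_le_deriv_boundary'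
    (fun x hx => (hf x hx).continuousAt.continuousWithinAt)
    (fun x hx => (hf x (Set.Ico_subset_Icc_self hx)).hasDerivWithinAt)
    (by simp)
    (fun x hx => (hB x hx).continuousAt.continuousWithinAt)
    (fun x hx => (hB x (Set.Ico_subset_Icc_self hx)).hasDerivWithinAt)
    (fun x hx => by
      have hx' := Set.Ico_subset_Icc_self hx
      have hx0 := hpos x hx'
      rw [Real.norm_eq_abs]
      refine (abs_add_le _ _).trans ?_
      rw [abs_mul, abs_mul, abs_of_nonneg (by positivity : 0 ≤ ε / x),
        abs_of_nonneg (by positivity : 0 ≤ ε ^ 2 / x ^ 2)]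
      gcongr
      · exact hb₁ _ _
      · exact hb₂ x hx' _ _)
    (Set.right_mem_Icc.mpr hrL)
  rw [Real.norm_eq_abs, hφ, ← abs_neg] at bound
  rw [Real.log_div (hr₀.trans_le hrL).ne' hr₀.ne', one_div, one_div]
  convert bound using 2
  ring
end
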